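/- Let r, W, V, N be a solution of the BFM system on an open interval (ρ*, ρ_h) with N > 0 there, and suppose r, W, V, N extend continuously to ρ_h with N(ρ_h) = 0, r(ρ_h) > 0, and N is differentiable at ρ_h. Then the one-sided derivative satisfies N'(ρ_h) = (1/2)(1 − 2V(ρ_h)²/r(ρ_h)² − (1 − W(ρ_h)²)²/r(ρ_h)²). Consequently, if N'(ρ_h) > 0 (a regular horizon), then r(ρ_h)² > (1 − W(ρ_h)²)² + 2V(ρ_h)², and in particular r(ρ_h) > 1 − W(ρ_h)². -/

import Mathlib

/-- The function `κ = (1/(2N))(1 + N² + 2V²/r² − (1−W²)²/r²)` built from the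
unknowns of the BFM system. -/
noncomputable def bfmKappa (r W V N : ℝ → ℝ) (ρ : ℝ) : ℝ :=
  1 / (2 * N ρ) * (1 + N ρ ^ 2 + 2 * V ρ ^ 2 / r ρ ^ 2 - (1 - W ρ ^ 2) ^ 2 / r ρ ^ 2)

/-- `r, W, V, N` is a solution of the BFM system on the set `I`:
`ṙ = rN`, `Ẇ = V`, `V̇ = (2N−κ)V − W(1−W²)`, `Ṅ = (κ−N)N − 2V²/r²`,
with `r > 0` and `N ≠ 0` on `I`. -/
def IsBFMSolution (I : Set ℝ) (r W V N : ℝ → ℝ) : Prop :=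
  (∀ ρ ∈ I, 0 < r ρ) ∧ (∀ ρ ∈ I, N ρ ≠ 0) ∧
  (∀ ρ ∈ I, HasDerivAt r (r ρ * N ρ) ρ) ∧
  (∀ ρ ∈ I, HasDerivAt W (V ρ) ρ) ∧
  (∀ ρ ∈ I, HasDerivAt V ((2 * N ρ - bfmKappa r W V N ρ) * V ρ - W ρ * (1 - W ρ ^ 2)) ρ) ∧
  (∀ ρ ∈ I, HasDerivAt N ((bfmKappa r W V N ρ - N ρ) * N ρ - 2 * V ρ ^ 2 / r ρ ^ 2) ρ)

/-- Let `r, W, V, N` solve the BFM system on `(ρ*, ρ_h)` with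
`N > 0` there, extending continuously to `ρ_h` with `N(ρ_h) = 0`, `r(ρ_h) > 0`,
and suppose `N` has (one-sided) derivative `D` at `ρ_h`. Then
`D = (1/2)(1 − 2V(ρ_h)²/r(ρ_h)² − (1 − W(ρ_h)²)²/r(ρ_h)²)`; consequently if
`D > 0` (a regular horizon) then `r(ρ_h)² > (1 − W(ρ_h)²)² + 2V(ρ_h)²`, and in
particular `r(ρ_h) > 1 − W(ρ_h)²`. -/
theorem bfm_regular_horizon_ineq (ρstar ρh : ℝ) (hlt : ρstar < ρh) (r W V N : ℝ → ℝ)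
    (h : IsBFMSolution (Set.Ioo ρstar ρh) r W V N)
    (hNpos : ∀ ρ ∈ Set.Ioo ρstar ρh, 0 < N ρ)
    (hrc : ContinuousWithinAt r (Set.Ioo ρstar ρh) ρh)
    (hWc : ContinuousWithinAt W (Set.Ioo ρstar ρh) ρh)
    (hVc : ContinuousWithinAt V (Set.Ioo ρstar ρh) ρh)
    (hNc : ContinuousWithinAt N (Set.Ioo ρstar ρh) ρh)
    (hN0 : N ρh = 0) (hr0 : 0 < r ρh)
    (D : ℝ) (hD : HasDerivWithinAt N D (Set.Ioo ρstar ρh) ρh) :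
    D = 1 / 2 * (1 - 2 * V ρh ^ 2 / r ρh ^ 2 - (1 - W ρh ^ 2) ^ 2 / r ρh ^ 2) ∧
    (0 < D →
      r ρh ^ 2 > (1 - W ρh ^ 2) ^ 2 + 2 * V ρh ^ 2 ∧ r ρh > 1 - W ρh ^ 2) := by
  obtain ⟨-, hN, -, -, -, hN'⟩ := h
  have hcont : Filter.Tendsto
      (fun ρ => 1 / 2 * (1 + N ρ ^ 2 + 2 * V ρ ^ 2 / r ρ ^ 2 - (1 - W ρ ^ 2) ^ 2 / r ρ ^ 2)
        - N ρ ^ 2 - 2 * V ρ ^ 2 / r ρ ^ 2) (nhdsWithin ρh (Set.Ioo ρstar ρh))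
      (nhds (1 / 2 * (1 + N ρh ^ 2 + 2 * V ρh ^ 2 / r ρh ^ 2 - (1 - W ρh ^ 2) ^ 2 / r ρh ^ 2)
        - N ρh ^ 2 - 2 * V ρh ^ 2 / r ρh ^ 2)) := by
    have hr2 : r ρh ^ 2 ≠ 0 := by positivity
    have hV2 := ((hVc.pow 2).const_mul 2).div (hrc.pow 2) hr2
    have hW2 := (((hWc.pow 2).const_sub 1).pow 2).div (hrc.pow 2) hr2
    exact (((((hNc.pow 2).const_add 1).add hV2).sub hW2).const_mul (1 / 2)
      |>.sub (hNc.pow 2)).sub hV2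
  have hderiv : Filter.Tendsto (deriv N) (nhdsWithin ρh (Set.Iio ρh))
      (nhds (1 / 2 * (1 - 2 * V ρh ^ 2 / r ρh ^ 2 - (1 - W ρh ^ 2) ^ 2 / r ρh ^ 2))) := by
    rw [← nhdsWithin_Ioo_eq_nhdsLT hlt]
    convert hcont.congr' ?_ using 2
    · rw [hN0]
      ring
    · filter_upwards [self_mem_nhdsWithin] with ρ hρ
      rw [(hN' ρ hρ).deriv, bfmKappa]
      have := hN ρ hρ
      field_simp
  have hD' : D = 1 / 2 * (1 - 2 * V ρh ^ 2 / r ρh ^ 2 - (1 - W ρh ^ 2) ^ 2 / r ρh ^ 2) := by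
    have hIic := hasDerivWithinAt_Iic_of_tendsto_deriv
      (fun ρ hρ => (hN' ρ hρ).differentiableAt.differentiableWithinAt) hNc
      (Ioo_mem_nhdsLT hlt) hderiv
    have hu : UniqueDiffWithinAt ℝ (Set.Ioo ρstar ρh) ρh := by
      refine uniqueDiffWithinAt_convex (convex_Ioo _ _) ?_ ?_
      · simpa using hlt
      · rw [closure_Ioo hlt.ne]
        exact Set.right_mem_Icc.2 hlt.le
    exact hu.eq_deriv _ hD (hIic.mono fun ρ hρ => hρ.2.le)
  refine ⟨hD', fun hpos => ?_⟩
  have hr2 : r ρh ^ 2 > (1 - W ρh ^ 2) ^ 2 + 2 * V ρh ^ 2 := by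
    have hlt1 : ((1 - W ρh ^ 2) ^ 2 + 2 * V ρh ^ 2) / r ρh ^ 2 < 1 := by
      rw [add_div]
      linarith
    rwa [div_lt_one (by positivity)] at hlt1
  exact ⟨hr2, lt_of_pow_lt_pow_left₀ 2 hr0.le (by nlinarith [sq_nonneg (V ρh)])⟩
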